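/- arXiv:2312.09868 — 6 statements merged into one kernel-verified Lean document; each statement's English description precedes it below -/
import Mathlib

section
/- Let M be a rooted Kripke model, w a world of M, and φ a CTL formula. Then M, w ⊨ AF AG AF φ if and only if M, w ⊨ AG AF φ. -/
variable {α P : Type}

/-- A rooted Kripke model: worlds `W`, transition relation `R`,
labeling `η`, and root `r`. -/
structure KripkeModel (α P : Type) where
  W : Set α
  R : α → α → Prop
  η : α → Set P
  r : α

namespace KripkeModel

/-- The structural axioms of a rooted Kripke model: `W` is nonempty, the root lies
in `W`, `R ⊆ W × W`, and `R` is total (every world has an `R`-successor). -/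
def Valid (M : KripkeModel α P) : Prop :=
  M.W.Nonempty ∧ M.r ∈ M.W ∧
    (∀ u v, M.R u v → u ∈ M.W ∧ v ∈ M.W) ∧
    (∀ u ∈ M.W, ∃ v, M.R u v)

/-- An infinite sequence (1-indexed; position `0` is ignored) is a path
if consecutive positions are `R`-related. -/
def IsPath (M : KripkeModel α P) (π : ℕ → α) : Prop :=
  ∀ i, 1 ≤ i → M.R (π i) (π (i + 1))

/-- `Π(w)`: the set of paths starting at `w` (i.e. with `π 1 = w`). -/
def Paths (M : KripkeModel α P) (w : α) : Set (ℕ → α) :=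
  {π | π 1 = w ∧ M.IsPath π}

end KripkeModel

/-- CTL formulas. -/
inductive CTL (P : Type) where
  | top : CTL P
  | atom : P → CTL P
  | neg : CTL P → CTL P
  | and : CTL P → CTL P → CTL P
  | or : CTL P → CTL P → CTL P
  | EX : CTL P → CTL P
  | AX : CTL P → CTL P
  | EF : CTL P → CTL P
  | AF : CTL P → CTL P
  | EG : CTL P → CTL P
  | AG : CTL P → CTL P
  | EU : CTL P → CTL P → CTL P
  | AU : CTL P → CTL P → CTL P
  | ER : CTL P → CTL P → CTL P
  | AR : CTL P → CTL P → CTL P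

/-- CTL satisfaction `M, w ⊨ φ`. -/
def KripkeModel.Sat (M : KripkeModel α P) : CTL P → α → Prop
  | .top, _ => True
  | .atom p, w => p ∈ M.η w
  | .neg φ, w => ¬ M.Sat φ w
  | .and φ ψ, w => M.Sat φ w ∧ M.Sat ψ w
  | .or φ ψ, w => M.Sat φ w ∨ M.Sat ψ w
  | .EX φ, w => ∃ π ∈ M.Paths w, M.Sat φ (π 2)
  | .AX φ, w => ∀ π ∈ M.Paths w, M.Sat φ (π 2)
  | .EF φ, w => ∃ π ∈ M.Paths w, ∃ k, 1 ≤ k ∧ M.Sat φ (π k)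
  | .AF φ, w => ∀ π ∈ M.Paths w, ∃ k, 1 ≤ k ∧ M.Sat φ (π k)
  | .EG φ, w => ∃ π ∈ M.Paths w, ∀ k, 1 ≤ k → M.Sat φ (π k)
  | .AG φ, w => ∀ π ∈ M.Paths w, ∀ k, 1 ≤ k → M.Sat φ (π k)
  | .EU φ ψ, w => ∃ π ∈ M.Paths w, ∃ k, 1 ≤ k ∧ M.Sat ψ (π k) ∧
      ∀ i, 1 ≤ i → i < k → M.Sat φ (π i)
  | .AU φ ψ, w => ∀ π ∈ M.Paths w, ∃ k, 1 ≤ k ∧ M.Sat ψ (π k) ∧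
      ∀ i, 1 ≤ i → i < k → M.Sat φ (π i)
  | .ER φ ψ, w => ∃ π ∈ M.Paths w, ∀ k, 1 ≤ k →
      (M.Sat ψ (π k) ∨ ∃ i, 1 ≤ i ∧ i < k ∧ M.Sat φ (π i))
  | .AR φ ψ, w => ∀ π ∈ M.Paths w, ∀ k, 1 ≤ k →
      (M.Sat ψ (π k) ∨ ∃ i, 1 ≤ i ∧ i < k ∧ M.Sat φ (π i))

/-- `M ⊨ φ`, i.e. satisfaction at the root. -/
def KripkeModel.SatRoot (M : KripkeModel α P) (φ : CTL P) : Prop :=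
  M.Sat φ M.r

/-- `M'` is a connected submodel of `M`: `M'` is itself a rooted Kripke model
(nonempty world set, root, `R' ⊆ W' × W'` total), with `W' ⊆ W`, `R' ⊆ R`,
the same labeling on `W'`, the same root, and every world of `W'` reachable
from the root along a path of `M'`. -/
def KripkeModel.IsConnectedSubmodel (M' M : KripkeModel α P) : Prop :=
  M'.Valid ∧ M'.W ⊆ M.W ∧ (∀ u v, M'.R u v → M.R u v) ∧
    (∀ w ∈ M'.W, M'.η w = M.η w) ∧ M'.r = M.r ∧
    (∀ w ∈ M'.W, ∃ π ∈ M'.Paths M'.r, ∃ i, 1 ≤ i ∧ π i = w)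

namespace KripkeModel

/-- Every suffix of a path is a path. -/
theorem IsPath.suffix_mem_paths {M : KripkeModel α P} {π : ℕ → α} (h : M.IsPath π)
    {m : ℕ} (hm : 1 ≤ m) : (fun i => π (m + i - 1)) ∈ M.Paths (π m) := by
  refine ⟨by simp, fun i hi => ?_⟩
  have := h (m + i - 1) (by omega)
  rwa [show m + i - 1 + 1 = m + (i + 1) - 1 by omega] at this

/-- A finite initial segment of a path can be continued by any path starting at its last world. -/
theorem exists_paths_append {M : KripkeModel α P} {w : α} {π ρ : ℕ → α} {k : ℕ}
    (hπ : π ∈ M.Paths w) (hk : 1 ≤ k) (hρ : ρ ∈ M.Paths (π k)) :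
    ∃ σ ∈ M.Paths w, ∀ i, k ≤ i → σ i = ρ (i - k + 1) := by
  have key : ∀ i, k ≤ i → (if i ≤ k then π i else ρ (i - k + 1)) = ρ (i - k + 1) := by
    intro i hi
    split_ifs with h
    · obtain rfl : i = k := le_antisymm h hi
      simpa using hρ.1.symm
    · rfl
  refine ⟨fun i => if i ≤ k then π i else ρ (i - k + 1), ⟨by simp [hk, hπ.1], ?_⟩, key⟩
  intro i hi
  dsimp only
  rcases lt_or_ge i k with h | h
  · rw [if_pos h.le, if_pos (Nat.succ_le_of_lt h)]
    exact hπ.2 i hi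
  · rw [key i h, key (i + 1) (by omega), show i + 1 - k + 1 = i - k + 1 + 1 by omega]
    exact hρ.2 _ (by omega)

end KripkeModel

/-- `AF AG AF φ ≡ AG AF φ`. -/
theorem ctl_AF_AG_AF (M : KripkeModel α P) (hM : M.Valid) (w : α) (hw : w ∈ M.W)
    (φ : CTL P) :
    M.Sat (.AF (.AG (.AF φ))) w ↔ M.Sat (.AG (.AF φ)) w := by
  constructor
  · intro h π hπ k hk ρ hρ
    obtain ⟨σ, hσ, hσρ⟩ := KripkeModel.exists_paths_append hπ hk hρ
    obtain ⟨j, hj, hAG⟩ := h σ hσ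
    have hAF := hAG _ (hσ.2.suffix_mem_paths hj) (max j k - j + 1) (by omega)
    rw [show j + (max j k - j + 1) - 1 = max j k by omega] at hAF
    obtain ⟨n, hn, hφ⟩ := hAF _ (hσ.2.suffix_mem_paths (by omega))
    rw [hσρ _ (by omega)] at hφ
    exact ⟨_, by omega, hφ⟩
  · intro h π hπ
    refine ⟨1, le_rfl, ?_⟩
    rw [hπ.1]
    exact h
end

section
/- Let φ be a propositional formula in negation normal form over variables x_1, …, x_n (n ≥ 1), built from literals x_i and ¬x_i with ∧ and ∨. Let M(φ) be the rooted Kripke model with worlds {w_0} ∪ {w_i^0, w_i^1 : 1 ≤ i ≤ n}, relation R = {(w_0, w_1^k) : k ∈ {0,1}} ∪ {(w_i^k, w_{i+1}^l) : k, l ∈ {0,1}, 1 ≤ i < n} ∪ {(w_n^k, w_n^k) : k ∈ {0,1}}, root w_0, labeling η(w_0) = ∅ and η(w_i^k) = {x_i, x_i^k} for fresh propositions x_i^0, x_i^1. Let φ_AG be the CTL formula obtained from φ by replacing each positive literal x_i by AG(¬x_i ∨ x_i^1) and each negative literal ¬x_i by AG(¬x_i ∨ x_i^0). Then φ is satisfiable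 (has a satisfying Boolean assignment) if and only if there exists a connected submodel M' of M(φ) with M' ⊨ φ_AG. -/
variable {α P : Type}

/-- Propositional formulas in negation normal form over variables `x_1, …, x_n`
(represented by `Fin n`): literals `x_i` and `¬x_i`, closed under `∧` and `∨`. -/
inductive NNF (n : ℕ) where
  | pos : Fin n → NNF n
  | neg : Fin n → NNF n
  | and : NNF n → NNF n → NNF n
  | or : NNF n → NNF n → NNF n

/-- Evaluation of an NNF formula under a Boolean assignment. -/
def NNF.eval {n : ℕ} (I : Fin n → Bool) : NNF n → Bool
  | .pos i => I i
  | .neg i => !(I i)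
  | .and φ ψ => φ.eval I && ψ.eval I
  | .or φ ψ => φ.eval I || ψ.eval I

/-- The propositions: `Sum.inl i` is `x_i`, and `Sum.inr (i, b)` is `x_i^1`
(for `b = true`) resp. `x_i^0` (for `b = false`). -/
abbrev SatProp (n : ℕ) := Fin n ⊕ (Fin n × Bool)

/-- The worlds: `none` is `w_0`, and `some (i, b)` is `w_{i+1}^1` (for `b = true`)
resp. `w_{i+1}^0` (for `b = false`), i.e. `Fin n` indexes the variables `x_1 … x_n`. -/
abbrev SatWorld (n : ℕ) := Option (Fin n × Bool)

/-- The transition relation of `M(φ)`: from `w_0` to both first-level worlds,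
from level `i` to both worlds of level `i+1`, and self-loops at the last level. -/
def SatRel (n : ℕ) : SatWorld n → SatWorld n → Prop
  | none, some (j, _) => (j : ℕ) = 0
  | some (i, k), some (j, l) => ((j : ℕ) = (i : ℕ) + 1) ∨
      ((i : ℕ) = n - 1 ∧ j = i ∧ l = k)
  | _, none => False

/-- The Kripke model `M(φ)`: root `w_0` (labeled `∅`), world `w_i^k` labeled
`{x_i, x_i^k}`. -/
def SatModel (n : ℕ) : KripkeModel (SatWorld n) (SatProp n) where
  W := Set.univ
  R := SatRel n
  η := fun w => match w with
    | none => ∅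
    | some (i, k) => {Sum.inl i, Sum.inr (i, k)}
  r := none

/-- `φ_AG`: replace each positive literal `x_i` by `AG(¬x_i ∨ x_i^1)` and each
negative literal `¬x_i` by `AG(¬x_i ∨ x_i^0)`. -/
def NNF.toAG {n : ℕ} : NNF n → CTL (SatProp n)
  | .pos i => .AG (.or (.neg (.atom (Sum.inl i))) (.atom (Sum.inr (i, true))))
  | .neg i => .AG (.or (.neg (.atom (Sum.inl i))) (.atom (Sum.inr (i, false))))
  | .and φ ψ => .and φ.toAG ψ.toAG
  | .or φ ψ => .or φ.toAG ψ.toAG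

theorem KripkeModel.Valid.mem_of_mem_paths {M : KripkeModel α P} (hM : M.Valid) {w : α}
    {π : ℕ → α} (hπ : π ∈ M.Paths w) {k : ℕ} (hk : 1 ≤ k) : π k ∈ M.W :=
  (hM.2.2.1 _ _ (hπ.2 k hk)).1

theorem KripkeModel.Valid.exists_mem_paths {M : KripkeModel α P} (hM : M.Valid) {w : α}
    (hw : w ∈ M.W) : ∃ π, π ∈ M.Paths w := by
  choose f hf using fun u : M.W => hM.2.2.2 u u.2
  let g : M.W → M.W := fun u => ⟨f u, (hM.2.2.1 _ _ (hf u)).2⟩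
  refine ⟨fun k => (g^[k - 1] ⟨w, hw⟩ : M.W), rfl, fun i hi => ?_⟩
  obtain ⟨j, rfl⟩ := Nat.exists_eq_add_of_le' hi
  simp only [Nat.add_sub_cancel, Function.iterate_succ_apply']
  exact hf _

/-- A path of `SatModel n` from the root reaches level `k` after `k + 1` steps. -/
theorem SatModel.exists_eq_some_of_mem_paths {n : ℕ} {π : ℕ → SatWorld n}
    (hπ : π ∈ (SatModel n).Paths none) (k : ℕ) (hk : k < n) :
    ∃ b, π (k + 2) = some (⟨k, hk⟩, b) := by
  induction k with
  | zero =>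
    have h : SatRel n (π 1) (π 2) := hπ.2 1 le_rfl
    rw [hπ.1] at h
    rcases h2 : π 2 with _ | ⟨j, b⟩ <;> rw [h2] at h
    · exact h.elim
    · exact ⟨b, congrArg some (Prod.ext (Fin.ext h) rfl)⟩
  | succ k ih =>
    obtain ⟨b, hb⟩ := ih (by omega)
    have h : SatRel n (π (k + 2)) (π (k + 3)) := hπ.2 (k + 2) (by omega)
    rw [hb] at h
    rcases h2 : π (k + 3) with _ | ⟨j, c⟩ <;> rw [h2] at h
    · exact h.elim
    · rcases h with h | ⟨h, -⟩
      · exact ⟨c, congrArg some (Prod.ext (Fin.ext h) rfl)⟩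
      · simp only at h
        omega

/-- The submodel of `SatModel n` that keeps, at each level, the world chosen by `I`. -/
def assignmentModel {n : ℕ} (I : Fin n → Bool) : KripkeModel (SatWorld n) (SatProp n) where
  W := {w | ∀ i b, w = some (i, b) → b = I i}
  R := fun u v => SatRel n u v ∧ (∀ i b, u = some (i, b) → b = I i) ∧
    ∀ i b, v = some (i, b) → b = I i
  η := (SatModel n).η
  r := none

theorem assignmentModel_rel {n : ℕ} (I : Fin n → Bool) {i j : Fin n}
    (h : (j : ℕ) = i + 1 ∨ (i : ℕ) = n - 1 ∧ j = i) :
    (assignmentModel I).R (some (i, I i)) (some (j, I j)) := by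
  refine ⟨h.imp id fun h => ⟨h.1, h.2, by rw [h.2]⟩, ?_, ?_⟩ <;>
  · rintro _ _ ⟨⟩
    rfl

theorem assignmentModel_rel_none {n : ℕ} (I : Fin n → Bool) {j : Fin n} (h : (j : ℕ) = 0) :
    (assignmentModel I).R none (some (j, I j)) := by
  refine ⟨h, by simp, ?_⟩
  rintro _ _ ⟨⟩
  rfl

theorem assignmentModel_valid {n : ℕ} (hn : 1 ≤ n) (I : Fin n → Bool) :
    (assignmentModel I).Valid := by
  have hr : (assignmentModel I).r ∈ (assignmentModel I).W := by
    simp [assignmentModel]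
  refine ⟨⟨_, hr⟩, hr, fun u v h => h.2, ?_⟩
  rintro (_ | ⟨i, b⟩) hu
  · exact ⟨_, assignmentModel_rel_none I (j := ⟨0, hn⟩) rfl⟩
  · obtain rfl := hu i b rfl
    by_cases hi : (i : ℕ) + 1 < n
    · exact ⟨_, assignmentModel_rel I (j := ⟨i + 1, hi⟩) (Or.inl rfl)⟩
    · exact ⟨_, assignmentModel_rel I (Or.inr ⟨by omega, rfl⟩)⟩

theorem assignmentModel_isConnectedSubmodel {n : ℕ} (hn : 1 ≤ n) (I : Fin n → Bool) :
    (assignmentModel I).IsConnectedSubmodel (SatModel n) := by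
  have hv := assignmentModel_valid hn I
  refine ⟨hv, Set.subset_univ _, fun _ _ h => h.1, fun _ _ => rfl, rfl, fun w hw => ?_⟩
  obtain ⟨π, hπ⟩ := hv.exists_mem_paths hv.2.1
  refine ⟨π, hπ, ?_⟩
  rcases w with _ | ⟨i, b⟩
  · exact ⟨1, le_rfl, hπ.1⟩
  · obtain rfl := hw i b rfl
    obtain ⟨c, hc⟩ := SatModel.exists_eq_some_of_mem_paths
      ⟨hπ.1, fun k hk => (hπ.2 k hk).1⟩ i i.isLt
    obtain rfl := hv.mem_of_mem_paths hπ (by omega : 1 ≤ (i : ℕ) + 2) i c hc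
    exact ⟨i + 2, by omega, hc⟩

theorem assignmentModel_sat_AG {n : ℕ} (hn : 1 ≤ n) (I : Fin n → Bool) (i : Fin n) :
    (assignmentModel I).SatRoot
      (.AG (.or (.neg (.atom (Sum.inl i))) (.atom (Sum.inr (i, I i))))) := by
  intro π hπ k hk
  have hw := (assignmentModel_valid hn I).mem_of_mem_paths hπ hk
  rw [KripkeModel.Sat, or_iff_not_imp_left]
  intro h
  have h := not_not.1 h
  simp only [KripkeModel.Sat] at h ⊢
  rcases hx : π k with _ | ⟨j, b⟩ <;> rw [hx] at h
  · exact h.elim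
  · obtain rfl := hw j b hx
    obtain rfl : i = j := by simpa [assignmentModel, SatModel] using h
    simp [assignmentModel, SatModel]

theorem assignmentModel_satRoot_toAG {n : ℕ} (hn : 1 ≤ n) (I : Fin n → Bool) (φ : NNF n)
    (h : φ.eval I = true) : (assignmentModel I).SatRoot φ.toAG := by
  induction φ with
  | pos i =>
    have hi : I i = true := h
    have := assignmentModel_sat_AG hn I i
    rwa [hi] at this
  | neg i =>
    have hi : I i = false := by simpa [NNF.eval] using h
    have := assignmentModel_sat_AG hn I i
    rwa [hi] at this
  | and φ ψ ihφ ihψ =>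
    rw [NNF.eval, Bool.and_eq_true] at h
    exact ⟨ihφ h.1, ihψ h.2⟩
  | or φ ψ ihφ ihψ =>
    rw [NNF.eval, Bool.or_eq_true] at h
    exact h.imp ihφ ihψ

theorem KripkeModel.IsConnectedSubmodel.eq_of_sat_AG {n : ℕ}
    {M : KripkeModel (SatWorld n) (SatProp n)} (hM : M.IsConnectedSubmodel (SatModel n))
    {π : ℕ → SatWorld n} (hπ : π ∈ M.Paths M.r) {k : ℕ} (hk : 1 ≤ k) {i : Fin n} {b c : Bool}
    (hi : π k = some (i, b))
    (h : M.SatRoot (.AG (.or (.neg (.atom (Sum.inl i))) (.atom (Sum.inr (i, c)))))) :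
    b = c := by
  have h := h π hπ k hk
  have hη := hM.2.2.2.1 _ (hM.1.mem_of_mem_paths hπ hk)
  rw [hi] at hη
  simp only [KripkeModel.Sat, hi, hη] at h
  simpa [SatModel, eq_comm] using h

theorem KripkeModel.IsConnectedSubmodel.exists_eval {n : ℕ}
    {M : KripkeModel (SatWorld n) (SatProp n)} (hM : M.IsConnectedSubmodel (SatModel n)) :
    ∃ I : Fin n → Bool, ∀ φ : NNF n, M.SatRoot φ.toAG → φ.eval I = true := by
  obtain ⟨π, hπ⟩ := hM.1.exists_mem_paths hM.1.2.1
  choose I hI using fun i : Fin n => SatModel.exists_eq_some_of_mem_paths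
    ⟨hπ.1.trans hM.2.2.2.2.1, fun k hk => hM.2.2.1 _ _ (hπ.2 k hk)⟩ i i.isLt
  refine ⟨I, fun φ h => ?_⟩
  induction φ with
  | pos i => exact hM.eq_of_sat_AG hπ (by omega) (hI i) h
  | neg i => simpa [NNF.eval] using hM.eq_of_sat_AG hπ (by omega) (hI i) h
  | and φ ψ ihφ ihψ =>
    rw [NNF.eval, Bool.and_eq_true]
    exact ⟨ihφ h.1, ihψ h.2⟩
  | or φ ψ ihφ ihψ =>
    rw [NNF.eval, Bool.or_eq_true]
    exact Or.imp ihφ ihψ h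

/-- `φ` is satisfiable iff some connected submodel of `M(φ)` satisfies `φ_AG`. -/
theorem nnf_satisfiable_iff_exists_submodel (n : ℕ) (hn : 1 ≤ n) (φ : NNF n) :
    (∃ I : Fin n → Bool, φ.eval I = true) ↔
      ∃ M' : KripkeModel (SatWorld n) (SatProp n),
        M'.IsConnectedSubmodel (SatModel n) ∧ M'.SatRoot φ.toAG := by
  constructor
  · rintro ⟨I, hI⟩
    exact ⟨assignmentModel I, assignmentModel_isConnectedSubmodel hn I,
      assignmentModel_satRoot_toAG hn I φ hI⟩
  · rintro ⟨M', hM', h⟩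
    obtain ⟨I, hI⟩ := hM'.exists_eval
    exact ⟨I, hI φ h⟩
end

section
/- Let G = (V, E) be a finite directed graph, s, t ∈ V, and suppose every vertex u ≠ t has at least one outgoing edge. Let M(H) be the rooted Kripke model with worlds {w_v : v ∈ V} ∪ {ŵ}, relation R = {(w_u, w_v) : (u,v) ∈ E, u ≠ t} ∪ {(w_t, ŵ), (ŵ, ŵ)}, root w_s, and labeling η(w_v) = {x_v} for each v ∈ V and η(ŵ) = ∅. Then G has a Hamiltonian path from s to t if and only if there exists a connected submodel M' of M(H) with M' ⊨ ⋀_{v ∈ V} AF x_v. -/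
variable {α P : Type}

/-- A Hamiltonian path from `s` to `t`: a list of vertices following edges of
`E`, starting at `s`, ending at `t`, visiting every vertex exactly once. -/
def IsHamiltonianPath {V : Type} (E : V → V → Prop) (s t : V) (l : List V) : Prop :=
  l.Chain' E ∧ l.head? = some s ∧ l.getLast? = some t ∧ l.Nodup ∧ ∀ v : V, v ∈ l

/-- Worlds of `M(H)`: `some v` is `w_v`, and `none` is `ŵ`. -/
abbrev HamWorld (V : Type) := Option V

/-- The transition relation of `M(H)`. -/
def HamRel {V : Type} (E : V → V → Prop) (t : V) : HamWorld V → HamWorld V → Prop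
  | some u, some v => E u v ∧ u ≠ t
  | some u, none => u = t
  | none, none => True
  | none, some _ => False

/-- The Kripke model `M(H)` with root `w_s`, labeling `η(w_v) = {x_v}`
(propositions are identified with vertices) and `η(ŵ) = ∅`. -/
def HamModel {V : Type} (E : V → V → Prop) (s t : V) :
    KripkeModel (HamWorld V) V where
  W := Set.univ
  R := HamRel E t
  η := fun w => match w with
    | some v => {v}
    | none => ∅
  r := some s

/-- Conjunction of a list of CTL formulas. -/
def bigAnd {P : Type} : List (CTL P) → CTL P
  | [] => .top
  | φ :: l => .and φ (bigAnd l)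

theorem sat_bigAnd_map_iff {α P ι : Type} (M : KripkeModel α P) (w : α) (φ : ι → CTL P)
    (l : List ι) : M.Sat (bigAnd (l.map φ)) w ↔ ∀ i ∈ l, M.Sat (φ i) w := by
  induction l with
  | nil => simp [bigAnd, KripkeModel.Sat]
  | cons a l ih => simp [bigAnd, KripkeModel.Sat, ih]

/-- The submodel of the Hamiltonian model whose only path from the root follows the list `l`
and then stays in `none`. -/
def listModel {V : Type} (s : V) (l : List V) : KripkeModel (HamWorld V) V where
  W := Set.univ
  R := fun a b => ∃ n : ℕ, a = l[n]? ∧ b = l[n + 1]?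
  η := fun w => match w with
    | some v => {v}
    | none => ∅
  r := some s

theorem listModel_rel_getElem? {V : Type} {s : V} {l : List V} (hl : l.Nodup) {n : ℕ}
    {b : HamWorld V} (h : (listModel s l).R l[n]? b) : b = l[n + 1]? := by
  obtain ⟨m, hm, rfl⟩ := h
  rcases lt_or_ge n l.length with hn | hn
  · rw [(List.getElem?_inj hn hl).1 hm]
  · have hm' : l.length ≤ m := by
      rw [List.getElem?_eq_none hn] at hm
      exact List.getElem?_eq_none_iff.1 hm.symm
    rw [List.getElem?_eq_none (by omega), List.getElem?_eq_none (by omega)]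

theorem listModel_path_eq {V : Type} {s : V} {l : List V} (hl : l.Nodup)
    (hs : l.head? = some s) {π : ℕ → HamWorld V} (hπ : π ∈ (listModel s l).Paths (some s))
    (n : ℕ) : π (n + 1) = l[n]? := by
  induction n with
  | zero => rw [hπ.1, ← hs, List.head?_eq_getElem?]
  | succ n ih =>
    have h := hπ.2 (n + 1) (by omega)
    rw [ih] at h
    exact listModel_rel_getElem? hl h

theorem hamRel_of_listModel_rel {V : Type} {E : V → V → Prop} {s t : V} {l : List V}
    (h : IsHamiltonianPath E s t l) {a b : HamWorld V} (hab : (listModel s l).R a b) :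
    HamRel E t a b := by
  obtain ⟨hc, -, ht, hn, -⟩ := h
  obtain ⟨n, rfl, rfl⟩ := hab
  rw [List.getLast?_eq_getElem?] at ht
  rcases lt_trichotomy (n + 1) l.length with h | h | h
  · rw [List.getElem?_eq_getElem h, List.getElem?_eq_getElem (by omega : n < l.length)]
    refine ⟨List.isChain_iff_getElem.1 hc n h, fun e => ?_⟩
    rw [← e, ← List.getElem?_eq_getElem (by omega : n < l.length)] at ht
    have := (List.getElem?_inj (by omega) hn).1 ht
    omega
  · rw [← h, Nat.add_sub_cancel] at ht
    rw [ht, List.getElem?_eq_none (by omega)]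
    rfl
  · rw [List.getElem?_eq_none (by omega : l.length ≤ n), List.getElem?_eq_none (by omega)]
    trivial

theorem exists_listModel_index {V : Type} {l : List V} (hall : ∀ v : V, v ∈ l)
    (w : HamWorld V) : ∃ n : ℕ, l[n]? = w := by
  cases w with
  | none => exact ⟨l.length, by simp⟩
  | some v => exact List.mem_iff_getElem?.1 (hall v)

theorem listModel_isConnectedSubmodel {V : Type} {E : V → V → Prop} {s t : V} {l : List V}
    (h : IsHamiltonianPath E s t l) :
    (listModel s l).IsConnectedSubmodel (HamModel E s t) := by
  have hidx := exists_listModel_index h.2.2.2.2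
  refine ⟨⟨⟨none, trivial⟩, trivial, fun _ _ _ => ⟨trivial, trivial⟩, fun u _ => ?_⟩,
    fun _ _ => trivial, fun _ _ => hamRel_of_listModel_rel h, fun _ _ => rfl, rfl, fun w _ => ?_⟩
  · obtain ⟨n, hn⟩ := hidx u
    exact ⟨_, n, hn.symm, rfl⟩
  · obtain ⟨n, hn⟩ := hidx w
    refine ⟨fun i => l[i - 1]?, ⟨?_, fun i hi => ⟨i - 1, rfl, ?_⟩⟩, n + 1, by omega, hn⟩
    · exact List.head?_eq_getElem?.symm.trans h.2.1
    · simp only [Nat.sub_add_cancel hi, Nat.add_sub_cancel]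

theorem listModel_sat_AF {V : Type} {E : V → V → Prop} {s t : V} {l : List V}
    (h : IsHamiltonianPath E s t l) (v : V) :
    (listModel s l).Sat (.AF (.atom v)) (some s) := by
  intro π hπ
  obtain ⟨n, hn⟩ := exists_listModel_index h.2.2.2.2 (some v)
  refine ⟨n + 1, by omega, ?_⟩
  rw [listModel_path_eq h.2.2.2.1 h.2.1 hπ, hn]
  exact Set.mem_singleton v

theorem KripkeModel.Valid.exists_successor_map {α P : Type} {M : KripkeModel α P}
    (hM : M.Valid) : ∃ f : α → α, ∀ n : ℕ, M.R (f^[n] M.r) (f^[n + 1] M.r) := by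
  classical
  have hsucc : ∀ u, ∃ v, u ∈ M.W → M.R u v := fun u => by
    by_cases hu : u ∈ M.W
    · obtain ⟨v, hv⟩ := hM.2.2.2 u hu
      exact ⟨v, fun _ => hv⟩
    · exact ⟨u, fun h => absurd h hu⟩
  choose f hf using hsucc
  have hmem : ∀ n : ℕ, f^[n] M.r ∈ M.W := fun n => by
    induction n with
    | zero => exact hM.2.1
    | succ n ih =>
      rw [Function.iterate_succ_apply']
      exact (hM.2.2.1 _ _ (hf _ ih)).2
  refine ⟨f, fun n => ?_⟩
  rw [Function.iterate_succ_apply']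
  exact hf _ (hmem n)

theorem Function.iterate_ne_of_first_hit {α : Type} {f : α → α} {x y : α} {k : ℕ}
    (hk : f^[k] x = y) (hmin : ∀ m < k, f^[m] x ≠ y) {i j : ℕ} (hij : i < j) (hj : j ≤ k) :
    f^[i] x ≠ f^[j] x := by
  intro e
  refine hmin ((k - j) + i) (by omega) ?_
  rw [Function.iterate_add_apply, e, ← Function.iterate_add_apply, Nat.sub_add_cancel hj, hk]

theorem hamRel_sequence_eq_none {V : Type} {E : V → V → Prop} {t : V} {p : ℕ → HamWorld V}
    (hp : ∀ n, HamRel E t (p n) (p (n + 1))) {m n : ℕ} (hmn : m ≤ n) (hm : p m = none) :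
    p n = none := by
  induction n, hmn using Nat.le_induction with
  | base => exact hm
  | succ n _ ih =>
    have h := hp n
    rw [ih] at h
    cases e : p (n + 1) with
    | none => rfl
    | some v => rw [e] at h; exact h.elim

theorem exists_isHamiltonianPath_of_iterate {V : Type} {E : V → V → Prop} {s t : V}
    {f : HamWorld V → HamWorld V}
    (hp : ∀ n : ℕ, HamRel E t (f^[n] (some s)) (f^[n + 1] (some s)))
    (hall : ∀ v : V, ∃ n : ℕ, f^[n] (some s) = some v) :
    ∃ l : List V, IsHamiltonianPath E s t l := by
  classical
  obtain ⟨k, hk, hmin⟩ : ∃ k : ℕ, f^[k] (some s) = some t ∧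
      ∀ m < k, f^[m] (some s) ≠ some t :=
    ⟨Nat.find (hall t), Nat.find_spec (hall t), fun m hm => Nat.find_min (hall t) hm⟩
  have hsome : ∀ n ≤ k, f^[n] (some s) = some ((f^[n] (some s)).getD s) := fun n hn => by
    cases e : f^[n] (some s) with
    | none =>
      have := hamRel_sequence_eq_none (p := fun n => f^[n] (some s)) hp hn e
      simp [hk] at this
    | some v => rfl
  have hafter : f^[k + 1] (some s) = none := by
    have h := hp k
    rw [hk] at h
    cases e : f^[k + 1] (some s) with
    | none => rfl
    | some v => rw [e] at h; exact (h.2 rfl).elim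
  refine ⟨(List.range (k + 1)).map fun n => (f^[n] (some s)).getD s, ?_, ?_, ?_, ?_, ?_⟩
  · refine List.isChain_iff_getElem.2 fun i hi => ?_
    simp only [List.length_map, List.length_range] at hi
    simp only [List.getElem_map, List.getElem_range]
    have h := hp i
    rw [hsome i (by omega), hsome (i + 1) (by omega)] at h
    exact h.1
  · simp [List.head?_range]
  · simp [List.range_succ, hk]
  · refine List.Nodup.map_on (fun i hi j hj e => ?_) List.nodup_range
    rw [List.mem_range] at hi hj
    have e' : f^[i] (some s) = f^[j] (some s) := by
      rw [hsome i (by omega), hsome j (by omega), e]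
    rcases lt_trichotomy i j with h | h | h
    · exact absurd e' (Function.iterate_ne_of_first_hit hk hmin h (by omega))
    · exact h
    · exact absurd e'.symm (Function.iterate_ne_of_first_hit hk hmin h (by omega))
  · intro v
    obtain ⟨n, hn⟩ := hall v
    refine List.mem_map.2 ⟨n, List.mem_range.2 ?_, by rw [hn]; rfl⟩
    by_contra hlt
    have := hamRel_sequence_eq_none (p := fun n => f^[n] (some s)) hp
      (by omega : k + 1 ≤ n) hafter
    simp [hn] at this

/-- `G` has a Hamiltonian path from `s` to `t` iff some connected submodel of
`M(H)` satisfies `⋀_{v ∈ V} AF x_v`. -/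
theorem hamPath_iff_exists_submodel_AF (V : Type) [Fintype V] (E : V → V → Prop)
    (s t : V) (htotal : ∀ u : V, u ≠ t → ∃ v : V, E u v) :
    (∃ l : List V, IsHamiltonianPath E s t l) ↔
      ∃ M' : KripkeModel (HamWorld V) V,
        M'.IsConnectedSubmodel (HamModel E s t) ∧
        M'.SatRoot (bigAnd (Finset.univ.toList.map fun v : V => CTL.AF (.atom v))) := by
  constructor
  · rintro ⟨l, hl⟩
    exact ⟨listModel s l, listModel_isConnectedSubmodel hl,
      (sat_bigAnd_map_iff _ _ _ _).2 fun v _ => listModel_sat_AF hl v⟩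
  · rintro ⟨M', ⟨hval, -, hR, hη, hr, -⟩, hsat⟩
    obtain ⟨f, hf⟩ := hval.exists_successor_map
    have hsat' := (sat_bigAnd_map_iff _ _ _ _).1 hsat
    have hr' : M'.r = some s := hr
    refine exists_isHamiltonianPath_of_iterate (f := f) (fun n => ?_) fun v => ?_
    · rw [← hr']
      exact hR _ _ (hf n)
    · obtain ⟨k, -, hk⟩ := hsat' v (by simp) (fun i => f^[i - 1] M'.r)
        ⟨rfl, fun i hi => by
          have h := hf (i - 1)
          rw [Nat.sub_add_cancel hi] at h
          exact h⟩
      refine ⟨k - 1, ?_⟩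
      have hk' : v ∈ M'.η (f^[k - 1] M'.r) := hk
      rw [hη _ (hval.2.2.1 _ _ (hf (k - 1))).1, hr'] at hk'
      cases e : f^[k - 1] (some s) with
      | none => rw [e] at hk'; exact hk'.elim
      | some u => rw [e] at hk'; exact congrArg some (Set.mem_singleton_iff.1 hk').symm
end

section
/- Let G = (V, E) be a finite directed graph with n = |V|, s, t ∈ V, and suppose every vertex u ≠ t has at least one outgoing edge. Let M_AU(H) be the rooted Kripke model with worlds {w_v, ŵ_v, w_{v,i} : v ∈ V, 1 ≤ i ≤ n}, relation R = {(w_v, w_{v,i}), (w_{v,i}, ŵ_v) : v ∈ V, 1 ≤ i ≤ n} ∪ {(ŵ_u, w_v) : (u,v) ∈ E, u ≠ t} ∪ {(ŵ_t, ŵ_t)}, root w_s, and labeling η(w_{v,i}) = {x_i} for 1 ≤ i ≤ n, η(ŵ_t) = {x_t}, and all other worlds labeled ∅. Define CTL formulas φ_0 = ⊤ AU x_t and φ_i = φ_{i-1} AU x_i for 1 ≤ i ≤ n. Then G has a Hamiltonian path from s to t if and only if there exists a connected submodel M' of M_AU(H) with M' ⊨ φ_n. -/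
variable {α P : Type}

/-- Worlds of `M_AU(H)`: `node v` is `w_v`, `hat v` is `ŵ_v`, and `mid v i` is
`w_{v,i+1}` (so `i : Fin n` ranges over the indices `1, …, n`). -/
inductive AUWorld (V : Type) (n : ℕ) where
  | node : V → AUWorld V n
  | hat : V → AUWorld V n
  | mid : V → Fin n → AUWorld V n

/-- Propositions: `some i` is `x_i` (for `1 ≤ i ≤ n`), and `none` is `x_t`. -/
abbrev AUProp := Option ℕ

/-- The transition relation of `M_AU(H)`. -/
def AURel {V : Type} {n : ℕ} (E : V → V → Prop) (t : V) :
    AUWorld V n → AUWorld V n → Prop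
  | .node v, .mid v' _ => v' = v
  | .mid v _, .hat v' => v' = v
  | .hat u, .node v => E u v ∧ u ≠ t
  | .hat u, .hat v => u = t ∧ v = t
  | _, _ => False

/-- The labeling of `M_AU(H)`: `η(w_{v,i}) = {x_i}`, `η(ŵ_t) = {x_t}`, all other
worlds labeled `∅`. -/
def AULabel {V : Type} {n : ℕ} (t : V) : AUWorld V n → Set AUProp
  | .mid _ i => {some ((i : ℕ) + 1)}
  | .hat v => {p | v = t ∧ p = none}
  | .node _ => ∅

/-- The Kripke model `M_AU(H)` with `n = |V|` and root `w_s`. -/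
def AUModel (V : Type) [Fintype V] (E : V → V → Prop) (s t : V) :
    KripkeModel (AUWorld V (Fintype.card V)) AUProp where
  W := Set.univ
  R := AURel E t
  η := AULabel t
  r := .node s

/-- The formulas `φ_0 = ⊤ AU x_t` and `φ_i = φ_{i-1} AU x_i`. -/
def phiAU : ℕ → CTL AUProp
  | 0 => .AU .top (.atom none)
  | i + 1 => .AU (phiAU i) (.atom (some (i + 1)))

namespace KripkeModel

/-- Satisfaction of `AU` in terms of sequences indexed from `0`. -/
theorem sat_AU_iff (M : KripkeModel α P) (φ ψ : CTL P) (w : α) :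
    M.Sat (.AU φ ψ) w ↔ ∀ ρ : ℕ → α, ρ 0 = w → (∀ i, M.R (ρ i) (ρ (i + 1))) →
      ∃ k, M.Sat ψ (ρ k) ∧ ∀ i < k, M.Sat φ (ρ i) := by
  simp only [Sat]
  constructor
  · intro h ρ h0 hρ
    obtain ⟨k, hk, hψ, hφ⟩ := h (fun i => ρ (i - 1)) ⟨by simpa using h0, fun i hi => by
      obtain ⟨j, rfl⟩ := Nat.exists_eq_add_of_le' hi
      exact hρ j⟩
    exact ⟨k - 1, hψ, fun i hi => hφ (i + 1) (by omega) (by omega)⟩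
  · rintro h π ⟨h1, hπ⟩
    obtain ⟨k, hψ, hφ⟩ := h (fun i => π (i + 1)) h1 fun i => hπ (i + 1) (by omega)
    refine ⟨k + 1, by omega, hψ, fun i hi hik => ?_⟩
    obtain ⟨j, rfl⟩ := Nat.exists_eq_add_of_le' hi
    exact hφ j (by omega)

/-- The Kripke model on the orbit of `r` under `f`, where the only successor of `u` is `f u`. -/
def orbit (f : α → α) (η : α → Set P) (r : α) : KripkeModel α P where
  W := Set.range fun q => f^[q] r
  R u w := u ∈ Set.range (fun q => f^[q] r) ∧ w = f u
  η := η
  r := r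

theorem orbit_isConnectedSubmodel (M : KripkeModel α P) (f : α → α) (hW : M.W = Set.univ)
    (hf : ∀ u, M.R u (f u)) : (orbit f M.η M.r).IsConnectedSubmodel M := by
  refine ⟨⟨⟨M.r, 0, rfl⟩, ⟨0, rfl⟩, ?_, fun u hu => ⟨f u, hu, rfl⟩⟩, by simp [hW], ?_,
    fun _ _ => rfl, rfl, ?_⟩
  · rintro _ _ ⟨⟨q, rfl⟩, rfl⟩
    exact ⟨⟨q, rfl⟩, q + 1, Function.iterate_succ_apply' f q M.r⟩
  · rintro u _ ⟨-, rfl⟩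
    exact hf u
  · rintro _ ⟨q, rfl⟩
    refine ⟨fun i => f^[i - 1] M.r, ⟨rfl, fun i hi => ?_⟩, q + 1, by omega, rfl⟩
    obtain ⟨j, rfl⟩ := Nat.exists_eq_add_of_le' hi
    exact ⟨⟨j, rfl⟩, Function.iterate_succ_apply' f j M.r⟩

theorem sat_AU_orbit {f : α → α} {η : α → Set P} {r : α} {φ ψ : CTL P} {q e : ℕ} (hqe : q ≤ e)
    (hψ : (orbit f η r).Sat ψ (f^[e] r))
    (hφ : ∀ j < e, (orbit f η r).Sat φ (f^[j] r)) :
    (orbit f η r).Sat (.AU φ ψ) (f^[q] r) := by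
  rw [sat_AU_iff]
  intro ρ h0 hρ
  have key : ∀ j, ρ j = f^[q + j] r := by
    intro j
    induction j with
    | zero => exact h0
    | succ j ih => rw [(hρ j).2, ih, ← Function.iterate_succ_apply' f, Nat.succ_eq_add_one, Nat.add_assoc]
  refine ⟨e - q, ?_, fun i hi => ?_⟩
  · rw [key, Nat.add_sub_cancel' hqe]
    exact hψ
  · rw [key]
    exact hφ _ (by omega)

end KripkeModel

/-- If a sequence following `R` repeats a value, it can be rerouted to repeat the part in between
forever, never leaving the values before the repetition. -/
theorem exists_lasso {α : Type*} {R : α → α → Prop} {ρ : ℕ → α}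
    (hρ : ∀ i, R (ρ i) (ρ (i + 1))) {a b : ℕ} (hab : a < b) (h : ρ a = ρ b) :
    ∃ σ : ℕ → α, σ 0 = ρ 0 ∧ (∀ i, R (σ i) (σ (i + 1))) ∧ ∀ i, ∃ j < b, σ i = ρ j := by
  let g : ℕ → ℕ := fun i => Nat.rec 0 (fun _ m => if m + 1 = b then a else m + 1) i
  have g_succ : ∀ i, g (i + 1) = if g i + 1 = b then a else g i + 1 := fun _ => rfl
  have g_lt : ∀ i, g i < b := by
    intro i
    induction i with
    | zero => exact lt_of_le_of_lt (Nat.zero_le a) hab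
    | succ i ih => rw [g_succ]; split_ifs <;> omega
  refine ⟨fun i => ρ (g i), rfl, fun i => ?_, fun i => ⟨g i, g_lt i, rfl⟩⟩
  have := hρ (g i)
  simp only [g_succ]
  split_ifs with hb
  · rwa [h, ← hb]
  · exact this

section Relation

variable {V : Type} {n : ℕ} {E : V → V → Prop} {t : V}

theorem AURel.of_node {v : V} {w : AUWorld V n} (h : AURel E t (.node v) w) :
    ∃ i, w = .mid v i := by
  cases w <;> simp_all [AURel]

theorem AURel.of_mid {v : V} {i : Fin n} {w : AUWorld V n} (h : AURel E t (.mid v i) w) :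
    w = .hat v := by
  cases w <;> simp_all [AURel]

theorem AURel.of_hat {v : V} {w : AUWorld V n} (h : AURel E t (.hat v) w) :
    (v = t ∧ w = .hat t) ∨ ∃ u, w = .node u ∧ E v u ∧ v ≠ t := by
  cases w <;> simp_all [AURel]

theorem AURel.eq_hat_of_le {ρ : ℕ → AUWorld V n} (hρ : ∀ i, AURel E t (ρ i) (ρ (i + 1)))
    {p q : ℕ} (hp : ρ p = .hat t) (hpq : p ≤ q) : ρ q = .hat t := by
  induction q, hpq using Nat.le_induction with
  | base => exact hp
  | succ q _ ih =>
    have h := hρ q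
    rw [ih] at h
    rcases h.of_hat with h | ⟨u, -, -, h⟩
    · exact h.2
    · exact absurd rfl h

/-- A sequence that starts at `node s` and first reaches the final loop at position `3 * N` runs
through `N` blocks of the form `node v`, `mid v i`, `hat v`. -/
theorem AURel.exists_block {ρ : ℕ → AUWorld V n} (hρ : ∀ i, AURel E t (ρ i) (ρ (i + 1)))
    {s : V} (h0 : ρ 0 = .node s) {N : ℕ} (hmin : ∀ m < N, ρ (3 * m) ≠ .hat t) :
    ∀ m < N, ∃ v i, ρ (3 * m) = .node v ∧ ρ (3 * m + 1) = .mid v i ∧ ρ (3 * m + 2) = .hat v := by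
  have block : ∀ {m v}, ρ (3 * m) = .node v →
      ∃ v i, ρ (3 * m) = .node v ∧ ρ (3 * m + 1) = .mid v i ∧ ρ (3 * m + 2) = .hat v := by
    intro m v hv
    have h₁ := hρ (3 * m)
    rw [hv] at h₁
    obtain ⟨i, hi⟩ := h₁.of_node
    have h₂ := hρ (3 * m + 1)
    rw [hi] at h₂
    exact ⟨v, i, hv, hi, h₂.of_mid⟩
  intro m
  induction m with
  | zero => exact fun _ => block h0
  | succ m ih =>
    intro hm
    obtain ⟨v, i, -, -, hv⟩ := ih (by omega)
    have h := hρ (3 * m + 2)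
    rw [hv] at h
    rcases h.of_hat with h | ⟨u, hu, -⟩
    · exact absurd h.2 (hmin (m + 1) hm)
    · exact block hu

end Relation

/-- A connected submodel satisfying `φ_n` yields a Hamiltonian path. -/
theorem exists_hamPath_of_submodel {V : Type} [Fintype V] {E : V → V → Prop} {s t : V}
    {M : KripkeModel (AUWorld V (Fintype.card V)) AUProp}
    (hM : M.IsConnectedSubmodel (AUModel V E s t))
    (hsat : M.SatRoot (phiAU (Fintype.card V))) :
    ∃ l : List V, IsHamiltonianPath E s t l := by
  obtain ⟨⟨-, hroot, hmem, htot⟩, -, hsub, hlab, hr, -⟩ := hM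
  replace hr : M.r = .node s := hr
  rw [KripkeModel.SatRoot, hr] at hsat
  rw [hr] at hroot
  have hW : ∀ {ρ : ℕ → AUWorld V (Fintype.card V)}, (∀ i, M.R (ρ i) (ρ (i + 1))) →
      ∀ i, ρ i ∈ M.W := fun hρ i => (hmem _ _ (hρ i)).1
  have hatom : ∀ {w p}, w ∈ M.W → (M.Sat (.atom p) w ↔ p ∈ AULabel t w) := by
    intro w p hw
    rw [KripkeModel.Sat, hlab w hw]
    rfl
  choose! f hf using htot
  let ρ : ℕ → AUWorld V (Fintype.card V) := fun i => f^[i] (.node s)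
  have h0 : ρ 0 = .node s := rfl
  have hρmem : ∀ i, ρ i ∈ M.W := by
    intro i
    induction i with
    | zero => exact hroot
    | succ i ih =>
      have := (hmem _ _ (hf _ ih)).2
      rwa [← Function.iterate_succ_apply' f] at this
  have hρ : ∀ i, M.R (ρ i) (ρ (i + 1)) := by
    intro i
    have := hf _ (hρmem i)
    rwa [← Function.iterate_succ_apply' f] at this
  clear_value ρ
  have hρE : ∀ i, AURel E t (ρ i) (ρ (i + 1)) := fun i => hsub _ _ (hρ i)
  have hphi0 : M.Sat (phiAU 0) (.node s) := by
    suffices h : ∀ k, M.Sat (phiAU k) (.node s) → M.Sat (phiAU 0) (.node s) from h _ hsat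
    intro k
    induction k with
    | zero => exact id
    | succ k ih =>
      intro hsat
      refine ih ?_
      rw [phiAU, KripkeModel.sat_AU_iff] at hsat
      obtain ⟨k, hk, hlt⟩ := hsat ρ h0 hρ
      rw [← h0]
      refine hlt 0 (Nat.pos_of_ne_zero ?_)
      rintro rfl
      rw [hatom (hρmem 0), h0] at hk
      exact hk
  have reach : ∀ {σ : ℕ → AUWorld V (Fintype.card V)}, σ 0 = .node s →
      (∀ i, M.R (σ i) (σ (i + 1))) → ∃ k, σ k = .hat t := by
    intro σ hσ0 hσ
    rw [phiAU, KripkeModel.sat_AU_iff] at hphi0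
    obtain ⟨k, hk, -⟩ := hphi0 σ hσ0 hσ
    rw [hatom (hW hσ k)] at hk
    refine ⟨k, ?_⟩
    generalize σ k = w at hk
    cases w <;> simp_all [AULabel]
  have hex : ∃ N, ρ (3 * N) = .hat t := by
    obtain ⟨k, hk⟩ := reach h0 hρ
    exact ⟨k, AURel.eq_hat_of_le hρE hk (by omega)⟩
  classical
  obtain ⟨N, hN, hmin⟩ : ∃ N, ρ (3 * N) = .hat t ∧ ∀ m < N, ρ (3 * m) ≠ .hat t :=
    ⟨Nat.find hex, Nat.find_spec hex, fun m hm => Nat.find_min hex hm⟩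
  have hNpos : 0 < N := by
    rcases Nat.eq_zero_or_pos N with rfl | h
    · simp [h0] at hN
    · exact h
  have : Nonempty V := ⟨s⟩
  have : Nonempty (Fin (Fintype.card V)) := ⟨⟨0, Fintype.card_pos⟩⟩
  choose! v c hnode hmid hhat using AURel.exists_block hρE h0 hmin
  have pos_of_mid : ∀ {q u i}, ρ q = .mid u i → ∃ m < N, q = 3 * m + 1 := by
    intro q u i hq
    have hlt : q < 3 * N := by
      by_contra! h
      rw [AURel.eq_hat_of_le hρE hN h] at hq
      cases hq
    have hm : q / 3 < N := by omega
    refine ⟨q / 3, hm, ?_⟩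
    by_contra hne
    obtain h | h : q = 3 * (q / 3) ∨ q = 3 * (q / 3) + 2 := by omega
    · rw [h, hnode _ hm] at hq
      cases hq
    · rw [h, hhat _ hm] at hq
      cases hq
  have next : ∀ k m, m < N → M.Sat (phiAU (k + 1)) (ρ (3 * m)) →
      ∃ m' < N, m ≤ m' ∧ (c m' : ℕ) = k ∧ M.Sat (phiAU k) (ρ (3 * m')) := by
    intro k m hm h
    rw [phiAU, KripkeModel.sat_AU_iff] at h
    obtain ⟨d, hd, hlt⟩ := h (fun i => ρ (3 * m + i)) rfl fun i => hρ (3 * m + i)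
    rw [hatom (hρmem _)] at hd
    obtain ⟨u, i, hu⟩ : ∃ u i, ρ (3 * m + d) = .mid u i := by
      generalize ρ (3 * m + d) = w at hd
      cases w <;> simp_all [AULabel]
    obtain ⟨m', hm', he⟩ := pos_of_mid hu
    refine ⟨m', hm', by omega, ?_, ?_⟩
    · rw [he, hmid _ hm'] at hd
      simp only [AULabel, Set.mem_singleton_iff, Option.some.injEq] at hd
      omega
    · have := hlt (d - 1) (by omega)
      rwa [show 3 * m + (d - 1) = 3 * m' by omega] at this
  have bound : ∀ k m, m < N → (c m : ℕ) + 1 ≠ k → M.Sat (phiAU k) (ρ (3 * m)) →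
      m + 1 + k ≤ N := by
    intro k
    induction k with
    | zero => intro m hm _ _; omega
    | succ k ih =>
      intro m hm hne h
      obtain ⟨m', hm', hle, hc, hs⟩ := next k m hm h
      have hmm : m ≠ m' := by
        rintro rfl
        omega
      have := ih m' hm' (by omega) hs
      omega
  have hcard : Fintype.card V ≤ N := by
    obtain ⟨k, hk⟩ := Nat.exists_eq_add_of_le' (Fintype.card_pos (α := V))
    have hsat' : M.Sat (phiAU (k + 1)) (ρ (3 * 0)) := by
      rw [mul_zero, h0]
      exact hk ▸ hsat
    obtain ⟨m', hm', -, hc, hs⟩ := next k 0 hNpos hsat'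
    have := bound k m' hm' (by omega) hs
    omega
  have hne : ∀ a b, a < b → b < N → v a ≠ v b := by
    intro a b hab hb h
    obtain ⟨σ, hσ0, hσ, hσρ⟩ := exists_lasso hρ (a := 3 * a) (b := 3 * b) (by omega)
      (by rw [hnode a (by omega), hnode b hb, h])
    obtain ⟨k, hk⟩ := reach (hσ0.trans h0) hσ
    obtain ⟨j, hj, hσj⟩ := hσρ k
    exact hmin b hb (AURel.eq_hat_of_le hρE (hσj.symm.trans hk) hj.le)
  have hnodup : ((List.range N).map v).Nodup := by
    refine List.Nodup.map_on ?_ List.nodup_range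
    intro a ha b hb hab
    rw [List.mem_range] at ha hb
    rcases lt_trichotomy a b with h | h | h
    · exact absurd hab (hne a b h hb)
    · exact h
    · exact absurd hab.symm (hne b a h ha)
  refine ⟨(List.range N).map v, ?_, ?_, ?_, hnodup, ?_⟩
  · rw [List.Chain', List.isChain_iff_getElem]
    intro i hi
    simp only [List.length_map, List.length_range] at hi
    simp only [List.getElem_map, List.getElem_range]
    have h := hρE (3 * i + 2)
    rw [hhat i (by omega), show 3 * i + 2 + 1 = 3 * (i + 1) by omega, hnode (i + 1) hi] at h
    exact h.1
  · have h := hnode 0 hNpos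
    rw [mul_zero, h0] at h
    cases N with
    | zero => omega
    | succ N => simpa [List.range_succ_eq_map] using (AUWorld.node.inj h).symm
  · obtain ⟨N, rfl⟩ := Nat.exists_eq_add_of_le' hNpos
    have h := hρE (3 * N + 2)
    rw [hhat N (by omega), show 3 * N + 2 + 1 = 3 * (N + 1) by omega, hN] at h
    simpa [List.range_succ] using h.1
  · have hu : ((List.range N).map v).toFinset = Finset.univ := by
      apply Finset.eq_univ_of_card
      refine le_antisymm (Finset.card_le_univ _) ?_
      rw [List.toFinset_card_of_nodup hnodup]
      simpa using hcard
    intro u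
    rw [← List.mem_toFinset, hu]
    exact Finset.mem_univ u

/-- The successor map on worlds that follows an enumeration `v` of the vertices with inverse `idx`
and passes through the world labeled `x_{n-m}` at the vertex `v m`. -/
def AUWorld.step {V : Type} {n : ℕ} [DecidableEq V] (t : V) (hn : 0 < n) (v : ℕ → V)
    (idx : V → ℕ) : AUWorld V n → AUWorld V n
  | .node u => .mid u ⟨n - 1 - idx u, by omega⟩
  | .mid u _ => .hat u
  | .hat u => if u = t then .hat t else .node (v (idx u + 1))

/-- A Hamiltonian path yields a connected submodel satisfying `φ_n`. -/
theorem exists_submodel_of_hamPath {V : Type} [Fintype V] {E : V → V → Prop} {s t : V} {l : List V}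
    (hl : IsHamiltonianPath E s t l) :
    ∃ M : KripkeModel (AUWorld V (Fintype.card V)) AUProp,
      M.IsConnectedSubmodel (AUModel V E s t) ∧ M.SatRoot (phiAU (Fintype.card V)) := by
  classical
  obtain ⟨hchain, hhead, hlast, hnodup, hall⟩ := hl
  have hn : 0 < Fintype.card V := Fintype.card_pos_iff.2 ⟨s⟩
  have hlen : l.length = Fintype.card V := by
    rw [← List.toFinset_card_of_nodup hnodup, ← Finset.card_univ]
    congr 1
    ext u
    simp [hall u]
  let v : ℕ → V := fun m => l.getD m t
  have hv : ∀ m (hm : m < l.length), v m = l[m] := fun m hm => List.getD_eq_getElem l t hm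
  have hidx_lt : ∀ u, l.idxOf u < l.length := fun u => List.idxOf_lt_length_of_mem (hall u)
  have hidx : ∀ m < l.length, l.idxOf (v m) = m := by
    intro m hm
    rw [hv m hm]
    exact hnodup.idxOf_getElem m hm
  have hvidx : ∀ u, v (l.idxOf u) = u := by
    intro u
    rw [hv _ (hidx_lt u)]
    exact List.getElem_idxOf (hidx_lt u)
  have hv0 : v 0 = s := by
    rw [hv 0 (by omega)]
    rw [List.head?_eq_getElem?, List.getElem?_eq_getElem (by omega)] at hhead
    exact Option.some.inj hhead
  have hvlast : v (l.length - 1) = t := by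
    rw [hv _ (by omega)]
    rw [List.getLast?_eq_getElem?, List.getElem?_eq_getElem (by omega)] at hlast
    exact Option.some.inj hlast
  have hE : ∀ m, m + 1 < l.length → E (v m) (v (m + 1)) := by
    intro m hm
    rw [hv m (by omega), hv (m + 1) hm]
    rw [List.Chain', List.isChain_iff_getElem] at hchain
    exact hchain m hm
  clear_value v
  let f := AUWorld.step t hn v l.idxOf
  have hf : ∀ w, AURel E t w (f w) := by
    rintro (u | u | ⟨u, i⟩)
    · rfl
    · by_cases hu : u = t
      · simp [f, AUWorld.step, hu, AURel]
      · have hlt : l.idxOf u + 1 < l.length := by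
          have h₁ := hidx_lt u
          have h₂ : l.idxOf u ≠ l.length - 1 := by
            intro h
            rw [← h, hvidx] at hvlast
            exact hu hvlast
          omega
        have h := hE _ hlt
        rw [hvidx] at h
        simpa [f, AUWorld.step, hu, AURel] using h
    · rfl
  have hnode : ∀ m < l.length, f^[3 * m] (.node s) = .node (v m) := by
    intro m
    induction m with
    | zero => intro _; rw [hv0]; rfl
    | succ m ih =>
      intro hm
      have hne : v m ≠ t := by
        intro h
        have h' := hidx (l.length - 1) (by omega)
        rw [hvlast, ← h, hidx m (by omega)] at h'
        omega
      rw [show 3 * (m + 1) = 3 + 3 * m by ring, Function.iterate_add_apply, ih (by omega)]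
      simp [f, AUWorld.step, hne, hidx m (by omega)]
  have hmid : ∀ i (hi : i < l.length), f^[3 * (l.length - (i + 1)) + 1] (.node s) =
      .mid (v (l.length - (i + 1))) ⟨i, by omega⟩ := by
    intro i hi
    rw [Function.iterate_succ_apply', hnode _ (by omega)]
    simp only [f, AUWorld.step, hidx _ (show l.length - (i + 1) < l.length by omega)]
    congr 2
    omega
  have hhat : ∀ q, 3 * l.length - 1 ≤ q → f^[q] (.node s) = .hat t := by
    intro q hq
    induction q, hq using Nat.le_induction with
    | base =>
      rw [show 3 * l.length - 1 = 2 + 3 * (l.length - 1) by omega, Function.iterate_add_apply,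
        hnode _ (by omega), hvlast]
      rfl
    | succ q _ ih =>
      rw [Function.iterate_succ_apply', ih]
      simp [f, AUWorld.step]
  refine ⟨_, KripkeModel.orbit_isConnectedSubmodel (AUModel V E s t) f rfl hf, ?_⟩
  have main : ∀ i ≤ l.length, ∀ q ≤ 3 * (l.length - i) + 1,
      (KripkeModel.orbit f (AULabel t) (.node s)).Sat (phiAU i) (f^[q] (.node s)) := by
    intro i
    induction i with
    | zero =>
      intro _ q _
      refine KripkeModel.sat_AU_orbit (e := q + 3 * l.length) (by omega) ?_ fun _ _ => trivial
      rw [hhat _ (by omega)]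
      exact ⟨rfl, rfl⟩
    | succ i ih =>
      intro hi q hq
      refine KripkeModel.sat_AU_orbit hq ?_ fun j hj => ih (by omega) j (by omega)
      rw [hmid i hi]
      exact rfl
  exact main _ hlen.ge 0 (by omega)

/-- With `n = |V|`, `G` has a Hamiltonian path from `s` to `t` iff some connected
submodel of `M_AU(H)` satisfies `φ_n`. -/
theorem hamPath_iff_exists_submodel_AU (V : Type) [Fintype V] (E : V → V → Prop)
    (s t : V) (htotal : ∀ u : V, u ≠ t → ∃ v : V, E u v) :
    (∃ l : List V, IsHamiltonianPath E s t l) ↔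
      ∃ M' : KripkeModel (AUWorld V (Fintype.card V)) AUProp,
        M'.IsConnectedSubmodel (AUModel V E s t) ∧
        M'.SatRoot (phiAU (Fintype.card V)) := by
  constructor
  · rintro ⟨l, hl⟩
    exact exists_submodel_of_hamPath hl
  · rintro ⟨M', hM', hsat⟩
    exact exists_hamPath_of_submodel hM' hsat
end

section
/- Let M be a rooted Kripke model and x an atomic proposition. There exists a connected submodel M' of M with M' ⊨ AF x if and only if M ⊨ EF x. -/
variable {α P : Type}

namespace KripkeModel

theorem exists_mem_paths (M : KripkeModel α P)
    (htot : ∀ u ∈ M.W, ∃ v, M.R u v ∧ v ∈ M.W) {w : α} (hw : w ∈ M.W) :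
    ∃ π, π ∈ M.Paths w := by
  choose f hfR hfW using htot
  let g : M.W → M.W := fun u => ⟨f u u.2, hfW u u.2⟩
  refine ⟨fun n => (g^[n - 1] ⟨w, hw⟩ : M.W), rfl, fun i hi => ?_⟩
  obtain ⟨j, rfl⟩ := Nat.exists_eq_add_of_le' hi
  simp only [Nat.add_sub_cancel, Function.iterate_succ_apply']
  exact hfR _ _

theorem cons_mem_paths {M : KripkeModel α P} {u v : α} (huv : M.R u v) {π : ℕ → α}
    (hπ : π ∈ M.Paths v) : (fun n => if n ≤ 1 then u else π (n - 1)) ∈ M.Paths u := by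
  refine ⟨by simp, fun i hi => ?_⟩
  obtain ⟨j, rfl⟩ := Nat.exists_eq_add_of_le' hi
  rcases j with _ | j
  · simpa [hπ.1] using huv
  · simpa using hπ.2 (j + 1) (by omega)

theorem exists_mem_paths_through {M : KripkeModel α P}
    (htot : ∀ u ∈ M.W, ∃ v, M.R u v ∧ v ∈ M.W) {u w : α}
    (huw : Relation.ReflTransGen M.R u w) (hw : w ∈ M.W) :
    ∃ π ∈ M.Paths u, ∃ i, 1 ≤ i ∧ π i = w := by
  induction huw using Relation.ReflTransGen.head_induction_on with
  | refl =>
    obtain ⟨π, hπ⟩ := M.exists_mem_paths htot hw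
    exact ⟨π, hπ, 1, le_rfl, hπ.1⟩
  | head h _ ih =>
    obtain ⟨π, hπ, i, hi, rfl⟩ := ih
    refine ⟨_, cons_mem_paths h hπ, i + 1, by omega, ?_⟩
    simp [show ¬ i + 1 ≤ 1 by omega]

/-- A world satisfying `x` can be reached in at most `n` steps. -/
def ReachesWithin (M : KripkeModel α P) (x : P) : ℕ → α → Prop
  | 0, u => x ∈ M.η u
  | n + 1, u => M.ReachesWithin x n u ∨ ∃ v, M.R u v ∧ M.ReachesWithin x n v

theorem ReachesWithin.mono {M : KripkeModel α P} {x : P} {m n : ℕ} (hmn : m ≤ n) {u : α}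
    (h : M.ReachesWithin x m u) : M.ReachesWithin x n u := by
  induction hmn with
  | refl => exact h
  | step _ ih => exact Or.inl ih

theorem IsPath.reachesWithin {M : KripkeModel α P} {π : ℕ → α} (hπ : M.IsPath π) {x : P} (n : ℕ) :
    ∀ i, 1 ≤ i → x ∈ M.η (π (i + n)) → M.ReachesWithin x n (π i) := by
  induction n with
  | zero => exact fun i _ h => h
  | succ n ih =>
    intro i hi h
    refine Or.inr ⟨_, hπ i hi, ih (i + 1) (by omega) ?_⟩
    rwa [Nat.add_right_comm, Nat.add_assoc]

/-- Transitions that, outside the worlds satisfying `x`, get strictly closer to `x` whenever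
`x` is reachable. -/
def Approaches (M : KripkeModel α P) (x : P) (u v : α) : Prop :=
  M.R u v ∧ (x ∉ M.η u → ∀ n, M.ReachesWithin x (n + 1) u → M.ReachesWithin x n v)

theorem exists_approaches (M : KripkeModel α P) (x : P) {u : α} (hu : ∃ v, M.R u v) :
    ∃ v, M.Approaches x u v := by
  classical
  by_cases h : x ∉ M.η u ∧ ∃ n, M.ReachesWithin x n u
  · obtain ⟨hx, hn⟩ := h
    obtain ⟨m, hm⟩ : ∃ m, Nat.find hn = m + 1 :=
      Nat.exists_eq_succ_of_ne_zero fun h0 => hx (by simpa [h0, ReachesWithin] using Nat.find_spec hn)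
    have hspec := Nat.find_spec hn
    rw [hm] at hspec
    obtain h' | ⟨v, huv, hv⟩ := hspec
    · exact absurd h' (Nat.find_min hn (by omega))
    · refine ⟨v, huv, fun _ n h' => hv.mono ?_⟩
      have := Nat.find_min' hn h'
      omega
  · obtain ⟨v, huv⟩ := hu
    exact ⟨v, huv, fun hx n hn => absurd ⟨hx, _, hn⟩ h⟩

theorem exists_atom_of_approaches {M : KripkeModel α P} {x : P} {π : ℕ → α}
    (hπ : ∀ i, 1 ≤ i → M.Approaches x (π i) (π (i + 1))) (n : ℕ) :
    ∀ i, 1 ≤ i → M.ReachesWithin x n (π i) → ∃ k, 1 ≤ k ∧ x ∈ M.η (π k) := by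
  induction n with
  | zero => exact fun i hi h => ⟨i, hi, h⟩
  | succ n ih =>
    intro i hi h
    by_cases hx : x ∈ M.η (π i)
    · exact ⟨i, hi, hx⟩
    · exact ih (i + 1) (by omega) ((hπ i hi).2 hx n h)

/-- The worlds reachable from the root along transitions approaching `x`. -/
def approachSubmodel (M : KripkeModel α P) (x : P) : KripkeModel α P where
  W := {w | Relation.ReflTransGen (M.Approaches x) M.r w}
  R u v := Relation.ReflTransGen (M.Approaches x) M.r u ∧ M.Approaches x u v
  η := M.η
  r := M.r

theorem approachSubmodel_isConnectedSubmodel {M : KripkeModel α P} (hM : M.Valid) (x : P) :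
    (M.approachSubmodel x).IsConnectedSubmodel M := by
  obtain ⟨-, hr, hR, htot⟩ := hM
  have hsub : (M.approachSubmodel x).W ⊆ M.W := by
    intro w hw
    obtain h | ⟨u, -, h⟩ := Relation.ReflTransGen.cases_tail hw
    · exact h ▸ hr
    · exact (hR _ _ h.1).2
  have htot' : ∀ u ∈ (M.approachSubmodel x).W,
      ∃ v, (M.approachSubmodel x).R u v ∧ v ∈ (M.approachSubmodel x).W := by
    intro u hu
    obtain ⟨v, hv⟩ := M.exists_approaches x (htot u (hsub hu))
    exact ⟨v, ⟨hu, hv⟩, Relation.ReflTransGen.tail hu hv⟩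
  have hroot : M.r ∈ (M.approachSubmodel x).W := Relation.ReflTransGen.refl
  refine ⟨⟨⟨_, hroot⟩, hroot, fun u v h => ⟨h.1, h.1.tail h.2⟩, fun u hu => ?_⟩, hsub,
    fun u v h => h.2.1, fun _ _ => rfl, rfl, fun w hw => exists_mem_paths_through htot' ?_ hw⟩
  · exact (htot' u hu).imp fun _ h => h.1
  · change Relation.ReflTransGen _ M.r w
    induction (show Relation.ReflTransGen (M.Approaches x) M.r w from hw) with
    | refl => exact .refl
    | tail h h' ih => exact (ih h).tail ⟨h, h'⟩

end KripkeModel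

/-- There is a connected submodel satisfying `AF x` iff `M ⊨ EF x`. -/
theorem exists_submodel_AF_iff_EF (M : KripkeModel α P) (hM : M.Valid) (x : P) :
    (∃ M' : KripkeModel α P, M'.IsConnectedSubmodel M ∧ M'.SatRoot (.AF (.atom x))) ↔
      M.SatRoot (.EF (.atom x)) := by
  constructor
  · rintro ⟨M', ⟨hM', -, hR, hη, hr, -⟩, hAF⟩
    obtain ⟨-, hr', hR', htot⟩ := hM'
    obtain ⟨π, hπ⟩ := M'.exists_mem_paths
      (fun u hu => (htot u hu).imp fun v h => ⟨h, (hR' _ _ h).2⟩) hr'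
    obtain ⟨k, hk, hx⟩ := hAF π hπ
    refine ⟨π, ⟨hπ.1.trans hr, fun i hi => hR _ _ (hπ.2 i hi)⟩, k, hk, ?_⟩
    change x ∈ M.η (π k)
    rw [← hη _ (hR' _ _ (hπ.2 k hk)).1]
    exact hx
  · rintro ⟨π, hπ, k, hk, hx⟩
    obtain ⟨n, rfl⟩ := Nat.exists_eq_add_of_le hk
    refine ⟨M.approachSubmodel x, KripkeModel.approachSubmodel_isConnectedSubmodel hM x,
      fun ρ hρ => ?_⟩
    have h := hπ.2.reachesWithin n 1 le_rfl hx
    rw [hπ.1, show M.r = ρ 1 from hρ.1.symm] at h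
    exact KripkeModel.exists_atom_of_approaches (M := M) (fun i hi => (hρ.2 i hi).2) n 1 le_rfl h
end

section
/- Let M be a rooted Kripke model and x an atomic proposition. There exists a connected submodel M' of M with M' ⊨ AF AG x if and only if M ⊨ EF EG x. -/
variable {α P : Type}

namespace KripkeModel

theorem mem_paths_shift {M : KripkeModel α P} {w : α} {π : ℕ → α} (hπ : π ∈ M.Paths w)
    {k : ℕ} (hk : 1 ≤ k) : (fun n => π (n + (k - 1))) ∈ M.Paths (π k) := by
  refine ⟨by simp only; congr 1; omega, fun i hi => ?_⟩
  have h := hπ.2 (i + (k - 1)) (by omega)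
  rwa [show i + (k - 1) + 1 = i + 1 + (k - 1) by omega] at h

/-- If a path visits the world `u` at positions `i ≤ j`, cutting out the part in between
gives a path. -/
theorem mem_paths_shortcut {M : KripkeModel α P} {w : α} {π : ℕ → α} (hπ : π ∈ M.Paths w)
    {i j : ℕ} (hi : 1 ≤ i) (hij : i ≤ j) (h : π i = π j) :
    (fun n => if n < i then π n else π (n + (j - i))) ∈ M.Paths w := by
  constructor
  · by_cases h1 : 1 < i
    · simpa [h1] using hπ.1
    · obtain rfl : i = 1 := by omega
      simp only [lt_irrefl, if_false]
      rw [show 1 + (j - 1) = j by omega, ← h, hπ.1]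
  · intro n hn
    by_cases h1 : n + 1 < i
    · simpa [h1, show n < i by omega] using hπ.2 n hn
    · by_cases h2 : n < i
      · obtain rfl : i = n + 1 := by omega
        simp only [h2, h1, if_true, if_false]
        rw [show n + 1 + (j - (n + 1)) = j by omega, ← h]
        exact hπ.2 n hn
      · simp only [h2, h1, if_false]
        rw [show n + 1 + (j - i) = n + (j - i) + 1 by omega]
        exact hπ.2 _ (by omega)

theorem sat_EF_EG_atom_iff {M : KripkeModel α P} {x : P} {w : α} :
    M.Sat (.EF (.EG (.atom x))) w ↔
      ∃ k, 1 ≤ k ∧ ∃ π ∈ M.Paths w, ∀ n, k ≤ n → x ∈ M.η (π n) := by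
  simp only [Sat]
  constructor
  · rintro ⟨π, hπ, k, hk, τ, hτ, hx⟩
    refine ⟨k, hk, fun n => if n < k then π n else τ (n - k + 1), ⟨?_, fun n hn => ?_⟩,
      fun n hn => ?_⟩
    · by_cases h1 : 1 < k
      · simpa [h1] using hπ.1
      · obtain rfl : k = 1 := by omega
        simpa [hπ.1] using hτ.1
    · by_cases h1 : n + 1 < k
      · simpa [h1, show n < k by omega] using hπ.2 n hn
      · by_cases h2 : n < k
        · obtain rfl : k = n + 1 := by omega
          simpa [hτ.1] using hπ.2 n hn
        · simp only [h2, h1, if_false]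
          rw [show n + 1 - k + 1 = n - k + 1 + 1 by omega]
          exact hτ.2 _ (by omega)
    · simpa [show ¬ n < k by omega] using hx (n - k + 1) (by omega)
  · rintro ⟨k, hk, π, hπ, hx⟩
    exact ⟨π, hπ, k, hk, _, mem_paths_shift hπ hk, fun n hn => hx _ (by omega)⟩

/-- The submodel consisting of the worlds and transitions of the sequence `π`. -/
def alongPath (M : KripkeModel α P) (π : ℕ → α) : KripkeModel α P where
  W := {u | ∃ i, 1 ≤ i ∧ π i = u}
  R u v := ∃ i, 1 ≤ i ∧ π i = u ∧ π (i + 1) = v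
  η := M.η
  r := M.r

theorem isConnectedSubmodel_alongPath {M : KripkeModel α P} (hM : M.Valid) {π : ℕ → α}
    (hπ : π ∈ M.Paths M.r) : (M.alongPath π).IsConnectedSubmodel M := by
  refine ⟨⟨⟨π 1, 1, le_rfl, rfl⟩, ⟨1, le_rfl, hπ.1⟩, ?_, ?_⟩, ?_, ?_, fun _ _ => rfl, rfl, ?_⟩
  · rintro _ _ ⟨i, hi, rfl, rfl⟩
    exact ⟨⟨i, hi, rfl⟩, ⟨i + 1, by omega, rfl⟩⟩
  · rintro _ ⟨i, hi, rfl⟩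
    exact ⟨π (i + 1), i, hi, rfl, rfl⟩
  · rintro _ ⟨i, hi, rfl⟩
    exact (hM.2.2.1 _ _ (hπ.2 i hi)).1
  · rintro _ _ ⟨i, hi, rfl, rfl⟩
    exact hπ.2 i hi
  · rintro _ ⟨i, hi, rfl⟩
    exact ⟨π, ⟨hπ.1, fun j hj => ⟨j, hj, rfl, rfl⟩⟩, i, hi, rfl⟩

/-- If the worlds of `π` before position `k` occur only once on `π`, and `x` holds on `π` from
position `k` on, then `AF AG x` holds in the submodel along `π`. -/
theorem satRoot_alongPath {M : KripkeModel α P} {x : P} {π : ℕ → α} (hπ : π ∈ M.Paths M.r)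
    {k : ℕ} (hk : 1 ≤ k) (hx : ∀ n, k ≤ n → x ∈ M.η (π n))
    (hinj : ∀ i j, 1 ≤ i → i < k → 1 ≤ j → π i = π j → i = j) :
    (M.alongPath π).SatRoot (.AF (.AG (.atom x))) := by
  simp only [SatRoot, Sat]
  intro ρ hρ
  have hstart : ∀ n, 1 ≤ n → n ≤ k → ρ n = π n := by
    intro n hn
    induction n, hn using Nat.le_induction with
    | base => exact fun _ => hρ.1.trans hπ.1.symm
    | succ n hn ih =>
      intro hnk
      obtain ⟨i, hi, hi₁, hi₂⟩ := hρ.2 n hn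
      rw [ih (by omega)] at hi₁
      rw [← hi₂, hinj n i hn (by omega) hi hi₁.symm]
  refine ⟨k, hk, fun τ hτ n hn => ?_⟩
  have htail : ∃ j, k ≤ j ∧ π j = τ n := by
    induction n, hn using Nat.le_induction with
    | base => exact ⟨k, le_rfl, by rw [hτ.1, hstart k hk le_rfl]⟩
    | succ n hn ih =>
      obtain ⟨j, hj, hjn⟩ := ih
      obtain ⟨i, hi, hi₁, hi₂⟩ := hτ.2 n hn
      refine ⟨i + 1, ?_, hi₂⟩
      by_contra! hik
      have := hinj i j hi (by omega) (by omega) (hi₁.trans hjn.symm)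
      omega
  obtain ⟨j, hj, hjn⟩ := htail
  rw [← hjn]
  exact hx j hj

theorem IsConnectedSubmodel.satRoot_EF_EG_atom {M' M : KripkeModel α P}
    (h : M'.IsConnectedSubmodel M) {x : P} (hx : M'.SatRoot (.AF (.AG (.atom x)))) :
    M.SatRoot (.EF (.EG (.atom x))) := by
  obtain ⟨hV, -, hR, hη, hr, hreach⟩ := h
  obtain ⟨π, hπ, -⟩ := hreach _ hV.2.1
  simp only [SatRoot, Sat] at hx
  obtain ⟨k, hk, hAG⟩ := hx π hπ
  refine sat_EF_EG_atom_iff.2 ⟨k, hk, π, ⟨hπ.1.trans hr, fun i hi => hR _ _ (hπ.2 i hi)⟩,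
    fun n hn => ?_⟩
  have hmem := hAG _ (mem_paths_shift hπ hk) (n - k + 1) (by omega)
  simp only [show n - k + 1 + (k - 1) = n by omega] at hmem
  rwa [hη _ (hV.2.2.1 _ _ (hπ.2 n (by omega))).1] at hmem

end KripkeModel

/-- There is a connected submodel satisfying `AF AG x` iff `M ⊨ EF EG x`. -/
theorem exists_submodel_AFAG_iff_EFEG (M : KripkeModel α P) (hM : M.Valid) (x : P) :
    (∃ M' : KripkeModel α P, M'.IsConnectedSubmodel M ∧
        M'.SatRoot (.AF (.AG (.atom x)))) ↔
      M.SatRoot (.EF (.EG (.atom x))) := by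
  refine ⟨fun ⟨M', h, hx⟩ => h.satRoot_EF_EG_atom hx, fun h => ?_⟩
  classical
  have hex := KripkeModel.sat_EF_EG_atom_iff.1 h
  obtain ⟨hk, π, hπ, hx⟩ := Nat.find_spec hex
  have hmin := fun m => Nat.find_min hex (m := m)
  generalize Nat.find hex = k at hk hx hmin
  have hne : ∀ i j, 1 ≤ i → i < k → i < j → π i ≠ π j := by
    intro i j hi hik hij heq
    refine hmin (max i (k - (j - i))) (by omega) ⟨by omega, _,
      KripkeModel.mem_paths_shortcut hπ hi hij.le heq, fun n hn => ?_⟩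
    simpa [show ¬ n < i by omega] using hx (n + (j - i)) (by omega)
  refine ⟨_, KripkeModel.isConnectedSubmodel_alongPath hM hπ, KripkeModel.satRoot_alongPath hπ hk hx ?_⟩
  intro i j hi hik hj heq
  rcases lt_trichotomy i j with hij | hij | hij
  · exact (hne i j hi hik hij heq).elim
  · exact hij
  · exact (hne j i hj (hij.trans hik) hij heq.symm).elim
end
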